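/- Let n ≥ 2 and let ω be a nondegenerate alternating bilinear form on ℝ^{2n} (a linear symplectic form) which is irrational in the sense that there is no nonzero λ ∈ ℝ for which all the values λ·ω(e_i, e_j) on pairs of standard basis vectors are rational. Let l be an integer with 1 ≤ l ≤ n − 1 and let a be a nonzero alternating 2l-linear form on ℝ^{2n} all of whose values a(e_{i₁}, …, e_{i_{2l}}) on tuples of standard basis vectors are rational. Then there exists a linear complex structure J on ℝ^{2n} compatible with ω that does not preserve a, i.e., the alternating 2l-form (v₁, …, v_{2l}) ↦ a(J v₁, …, J v_{2l}) is different from a. -/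

import Mathlib

noncomputable section

/-- The standard basis vector `e i` of `ℝ^m` (viewed as `Fin m → ℝ`). -/
def stdVec (m : ℕ) (i : Fin m) : Fin m → ℝ := Pi.single i 1

def CompatJ {V : Type} [AddCommGroup V] [Module ℝ V] (B : V →ₗ[ℝ] V →ₗ[ℝ] ℝ)
    (J : V →ₗ[ℝ] V) : Prop :=
  (∀ v, J (J v) = -v) ∧ (∀ x y, B (J x) (J y) = B x y) ∧ (∀ v, v ≠ 0 → 0 < B v (J v))

theorem B_anti {V : Type} [AddCommGroup V] [Module ℝ V] (B : V →ₗ[ℝ] V →ₗ[ℝ] ℝ)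
    (alt : ∀ v, B v v = 0) (x y : V) : B x y = - B y x := by
  have h := alt (x + y)
  simp only [map_add, LinearMap.add_apply, alt] at h
  linarith

theorem exists_pos {V : Type} [AddCommGroup V] [Module ℝ V] (B : V →ₗ[ℝ] V →ₗ[ℝ] ℝ)
    (nd : ∀ v, v ≠ 0 → ∃ w, B v w ≠ 0) (v : V) (hv : v ≠ 0) : ∃ w, 0 < B v w := by
  obtain ⟨w, hw⟩ := nd v hv
  rcases lt_or_gt_of_ne hw with h | h
  · exact ⟨-w, by simp only [map_neg]; linarith⟩
  · exact ⟨w, h⟩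

/-- Compatible complex structures with prescribed value at one vector. -/
theorem exists_compat (N : ℕ) : ∀ (V : Type) [AddCommGroup V] [Module ℝ V]
    [FiniteDimensional ℝ V] (B : V →ₗ[ℝ] V →ₗ[ℝ] ℝ) (_ : ∀ v, B v v = 0)
    (_ : ∀ v, v ≠ 0 → ∃ w, B v w ≠ 0) (_ : Module.finrank ℝ V ≤ N) (u w : V) (_ : 0 < B u w),
    ∃ J : V →ₗ[ℝ] V, CompatJ B J ∧ J u = w := by
  induction N with
  | zero =>
    intro V _ _ _ B alt nd hN u w huw
    exfalso
    have h0 : Module.finrank ℝ V = 0 := by omega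
    have := Module.finrank_zero_iff.mp h0
    have hu : u = 0 := Subsingleton.elim _ _
    simp [hu] at huw
  | succ N ih =>
    intro V _ _ _ B alt nd hN u w huw
    have anti := B_anti B alt
    set s := B u w with hs
    have hs0 : s ≠ 0 := huw.ne'
    have hwu : B w u = -s := by rw [anti]
    let W : Submodule ℝ V := LinearMap.ker (B u) ⊓ LinearMap.ker (B w)
    have hWu : ∀ x : W, B u x = 0 := fun x => x.2.1
    have hWw : ∀ x : W, B w x = 0 := fun x => x.2.2
    have hWu' : ∀ x : W, B x u = 0 := fun x => by rw [anti, hWu, neg_zero]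
    have hWw' : ∀ x : W, B x w = 0 := fun x => by rw [anti, hWw, neg_zero]
    -- projection
    let p0 : V →ₗ[ℝ] V := LinearMap.id + (s⁻¹ • B w).smulRight u - (s⁻¹ • B u).smulRight w
    have hp0 : ∀ v, p0 v = v + (s⁻¹ * B w v) • u - (s⁻¹ * B u v) • w := fun v => by
      simp [p0]
    have hp0W : ∀ v, p0 v ∈ W := by
      intro v
      constructor
      · simp only [SetLike.mem_coe, LinearMap.mem_ker, hp0, map_add, map_sub, map_smul, alt, ← hs,
          smul_eq_mul]
        field_simp
        ring
      · simp only [SetLike.mem_coe, LinearMap.mem_ker, hp0, map_add, map_sub, map_smul, alt, hwu,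
          smul_eq_mul]
        field_simp
        ring
    let p : V →ₗ[ℝ] W := p0.codRestrict W hp0W
    have hp : ∀ v, (p v : V) = v + (s⁻¹ * B w v) • u - (s⁻¹ * B u v) • w := fun v => hp0 v
    have hdec : ∀ v, v = (p v : V) - (s⁻¹ * B w v) • u + (s⁻¹ * B u v) • w := fun v => by
      rw [hp]; abel
    have hpW : ∀ x : W, p x = x := fun x => by
      apply Subtype.ext
      rw [hp, hWu, hWw]; simp
    have hpu : p u = 0 := by
      apply Subtype.ext
      rw [hp, alt, hwu]; simp [hs0]
    have hpw : p w = 0 := by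
      apply Subtype.ext
      rw [hp, alt, ← hs]; simp [hs0]
    have hfin : Module.finrank ℝ W < Module.finrank ℝ V := by
      apply Submodule.finrank_lt
      intro htop
      have : u ∈ W := htop ▸ Submodule.mem_top
      have h2 : B w u = 0 := this.2
      rw [hwu] at h2
      apply hs0; linarith
    let BW : W →ₗ[ℝ] W →ₗ[ℝ] ℝ := B.domRestrict₁₂ W W
    have hBW : ∀ x y : W, BW x y = B x y := fun x y => rfl
    have altW : ∀ v, BW v v = 0 := fun v => alt v
    have ndW : ∀ v, v ≠ 0 → ∃ w, BW v w ≠ 0 := by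
      intro v hv
      obtain ⟨y, hy⟩ := nd v (fun h => hv (Subtype.ext h))
      refine ⟨p y, ?_⟩
      rw [hBW]
      rw [hdec y] at hy
      simpa [hWu', hWw'] using hy
    have hJW : ∃ JW : W →ₗ[ℝ] W, CompatJ BW JW := by
      by_cases h : ∃ v : W, v ≠ 0
      · obtain ⟨v, hv⟩ := h
        obtain ⟨y, hy⟩ := exists_pos BW ndW v hv
        obtain ⟨J, hJ, _⟩ := ih W BW altW ndW (by omega) v y hy
        exact ⟨J, hJ⟩
      · push Not at h
        refine ⟨0, fun v => by simp [h v], fun x y => by simp [h x], fun v hv => absurd (h v) hv⟩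
    obtain ⟨JW, h1, h2, h3⟩ := hJW
    let J : V →ₗ[ℝ] V := W.subtype ∘ₗ JW ∘ₗ p - (s⁻¹ • B w).smulRight w - (s⁻¹ • B u).smulRight u
    have hJ : ∀ v, J v = (JW (p v) : V) - (s⁻¹ * B w v) • w - (s⁻¹ * B u v) • u := fun v => by
      simp [J]
    have hJu : J u = w := by
      rw [hJ, hpu, hwu, alt]; simp [hs0]
    have hJw : J w = -u := by
      rw [hJ, hpw, alt, ← hs]; simp [hs0]
    have hJW : ∀ x : W, J x = JW x := fun x => by
      rw [hJ, hpW, hWu, hWw]; simp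
    have hJs : ∀ v, J v = (JW (p v) : V) - (s⁻¹ * B w v) • w + (s⁻¹ * B u v) • (-u) := fun v => by
      rw [hJ, smul_neg]; abel
    have key : ∀ (x y : W) (a b c d : ℝ), B ((x:V) + a • u + b • w) ((y:V) + c • u + d • w)
        = B x y + s * (a * d - b * c) := by
      intro x y a b c d
      simp only [map_add, map_smul, LinearMap.add_apply, LinearMap.smul_apply, hWu, hWw, hWu', hWw',
        alt, hwu, ← hs, smul_eq_mul]
      ring
    have hform : ∀ v, v = (p v : V) + (-(s⁻¹ * B w v)) • u + (s⁻¹ * B u v) • w := fun v => by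
      rw [hp, neg_smul]; abel
    have hJform : ∀ v, J v = (JW (p v) : V) + (-(s⁻¹ * B u v)) • u + (-(s⁻¹ * B w v)) • w :=
      fun v => by rw [hJ, neg_smul, neg_smul]; abel
    refine ⟨J, ⟨?_, ?_, ?_⟩, hJu⟩
    · intro v
      rw [hJform v]
      simp only [map_add, map_smul, hJu, hJw, hJW, h1]
      conv_rhs => rw [hform v]
      simp only [Submodule.coe_neg, smul_neg, neg_smul]
      abel
    · intro x y
      conv_rhs => rw [hform x, hform y]
      rw [hJform x, hJform y, key, key]
      have := h2 (p x) (p y)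
      rw [hBW, hBW] at this
      rw [this]; ring
    · intro v hv
      have e : B v (J v) = B (p v) (JW (p v)) + s * ((s⁻¹ * B w v)^2 + (s⁻¹ * B u v)^2) := by
        have q := key (p v) (JW (p v)) (-(s⁻¹ * B w v)) (s⁻¹ * B u v) (-(s⁻¹ * B u v))
          (-(s⁻¹ * B w v))
        rw [← hform v, ← hJform v] at q
        rw [q]
        ring
      rw [e]
      by_cases hpv : p v = 0
      · rw [hpv]
        simp only [map_zero, Submodule.coe_zero, LinearMap.zero_apply, zero_add]
        apply mul_pos huw
        by_contra hcon
        have e1 : s⁻¹ * B w v = 0 := by nlinarith [sq_nonneg (s⁻¹ * B w v), sq_nonneg (s⁻¹ * B u v)]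
        have e2 : s⁻¹ * B u v = 0 := by nlinarith [sq_nonneg (s⁻¹ * B w v), sq_nonneg (s⁻¹ * B u v)]
        apply hv
        rw [hform v, hpv, e1, e2]; simp
      · have := h3 (p v) hpv
        rw [hBW] at this
        positivity

/-- Symplectic transvection. -/
def Tv {V : Type} [AddCommGroup V] [Module ℝ V] (B : V →ₗ[ℝ] V →ₗ[ℝ] ℝ) (w : V) (t : ℝ) :
    V →ₗ[ℝ] V := LinearMap.id + (t • B w).smulRight w

theorem Tv_apply {V : Type} [AddCommGroup V] [Module ℝ V] (B : V →ₗ[ℝ] V →ₗ[ℝ] ℝ) (w : V) (t : ℝ)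
    (v : V) : Tv B w t v = v + (t * B w v) • w := by simp [Tv]

theorem Tv_comp {V : Type} [AddCommGroup V] [Module ℝ V] (B : V →ₗ[ℝ] V →ₗ[ℝ] ℝ)
    (alt : ∀ v, B v v = 0) (w : V) (t s : ℝ)
    (v : V) : Tv B w t (Tv B w s v) = Tv B w (t + s) v := by
  simp only [Tv_apply, map_add, map_smul, alt, smul_zero, mul_zero, zero_smul,
    add_zero, add_mul, add_smul]
  abel

theorem Tv_zero {V : Type} [AddCommGroup V] [Module ℝ V] (B : V →ₗ[ℝ] V →ₗ[ℝ] ℝ)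
    (w v : V) : Tv B w 0 v = v := by simp [Tv_apply]

theorem Tv_symp {V : Type} [AddCommGroup V] [Module ℝ V] (B : V →ₗ[ℝ] V →ₗ[ℝ] ℝ)
    (alt : ∀ v, B v v = 0) (w : V) (t : ℝ) (x y : V) :
    B (Tv B w t x) (Tv B w t y) = B x y := by
  simp only [Tv_apply, map_add, map_smul, alt, smul_eq_mul, LinearMap.add_apply,
    LinearMap.smul_apply]
  rw [B_anti B alt x w]; ring

section
variable {V : Type} [AddCommGroup V] [Module ℝ V]

theorem conj_compat (B : V →ₗ[ℝ] V →ₗ[ℝ] ℝ) (alt : ∀ v, B v v = 0) (J : V →ₗ[ℝ] V)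
    (hJ : CompatJ B J) (u : V) (t : ℝ) :
    CompatJ B (Tv B u t ∘ₗ J ∘ₗ Tv B u (-t)) := by
  obtain ⟨h1, h2, h3⟩ := hJ
  have c1 : ∀ v, Tv B u (-t) (Tv B u t v) = v := fun v => by
    rw [Tv_comp B alt, neg_add_cancel, Tv_zero]
  have c2 : ∀ v, Tv B u t (Tv B u (-t) v) = v := fun v => by
    rw [Tv_comp B alt, add_neg_cancel, Tv_zero]
  refine ⟨?_, ?_, ?_⟩
  · intro v
    simp only [LinearMap.comp_apply, c1, h1, map_neg, c2]
  · intro x y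
    simp only [LinearMap.comp_apply, Tv_symp B alt, h2]
  · intro v hv
    have hv' : Tv B u (-t) v ≠ 0 := fun h => hv (by rw [← c2 v, h, map_zero])
    have := h3 _ hv'
    rw [← Tv_symp B alt u t, c2] at this
    exact this

theorem inv_pair [FiniteDimensional ℝ V] (B : V →ₗ[ℝ] V →ₗ[ℝ] ℝ) (alt : ∀ v, B v v = 0)
    (nd : ∀ v, v ≠ 0 → ∃ w, B v w ≠ 0) {m : ℕ} (a : V [⋀^Fin m]→ₗ[ℝ] ℝ)
    (H : ∀ J, CompatJ B J → ∀ x : Fin m → V, a (fun i => J (x i)) = a x)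
    (u w : V) (huw : 0 < B u w) (t : ℝ) (x : Fin m → V) :
    a (fun i => Tv B u t (Tv B w (-t) (x i))) = a x := by
  obtain ⟨J, hJ, hJu⟩ := exists_compat _ V B alt nd le_rfl u w huw
  have e1 := H _ (conj_compat B alt J hJ u t) (fun i => - J (x i))
  have e2 := H J hJ (fun i => - J (x i))
  rw [← e2] at e1
  have e3 : ∀ v, J (Tv B u (-t) v) = Tv B w (-t) (J v) := fun v => by
    rw [Tv_apply, Tv_apply, map_add, map_smul, hJu, ← hJ.2.1 u v, hJu]
  simpa only [LinearMap.comp_apply, e3, map_neg, hJ.1, neg_neg] using e1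

theorem inv_Tv [FiniteDimensional ℝ V] (B : V →ₗ[ℝ] V →ₗ[ℝ] ℝ) (alt : ∀ v, B v v = 0)
    (nd : ∀ v, v ≠ 0 → ∃ w, B v w ≠ 0) {m : ℕ} (a : V [⋀^Fin m]→ₗ[ℝ] ℝ)
    (H : ∀ J, CompatJ B J → ∀ x : Fin m → V, a (fun i => J (x i)) = a x)
    (w : V) (t : ℝ) (x : Fin m → V) :
    a (fun i => Tv B w t (x i)) = a x := by
  by_cases hw : w = 0
  · simp [hw, Tv_apply]
  obtain ⟨u, hu⟩ := exists_pos B nd w hw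
  have hu' : 0 < B (-u) w := by
    rw [B_anti B alt]; simpa using hu
  have hu2 : 0 < B (-u) ((2:ℝ) • w) := by
    rw [map_smul, smul_eq_mul]; linarith
  have e1 := inv_pair B alt nd a H (-u) w hu' (t/3) x
  have e2 := inv_pair B alt nd a H (-u) _ hu2 (t/3) (fun i => Tv B w t (x i))
  have e3 : ∀ v, Tv B ((2:ℝ) • w) (-(t/3)) (Tv B w t v) = Tv B w (-(t/3)) v := by
    intro v
    have : ∀ v, Tv B ((2:ℝ) • w) (-(t/3)) v = Tv B w (-(4 * t/3)) v := by
      intro v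
      rw [Tv_apply, Tv_apply, map_smul, LinearMap.smul_apply, smul_smul, smul_eq_mul]
      congr 2; ring
    rw [this, Tv_comp B alt]
    congr 1; ring
  simp only [e3] at e2
  rw [← e2, e1]

/-- The derivation action of `θ ⊗ u` on `a`. -/
def Mder {m : ℕ} (a : V [⋀^Fin m]→ₗ[ℝ] ℝ) (θ : V →ₗ[ℝ] ℝ) (u : V) :
    MultilinearMap ℝ (fun _ : Fin m => V) ℝ :=
  ∑ i, a.toMultilinearMap.compLinearMap
    (Function.update (fun _ => LinearMap.id) i (θ.smulRight u))

theorem Mder_apply {m : ℕ} (a : V [⋀^Fin m]→ₗ[ℝ] ℝ) (θ : V →ₗ[ℝ] ℝ) (u : V) (x : Fin m → V) :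
    Mder a θ u x = ∑ i, θ (x i) * a (Function.update x i u) := by
  simp only [Mder, _root_.sum_apply, MultilinearMap.compLinearMap_apply]
  refine Finset.sum_congr rfl fun i _ => ?_
  have : (fun j => (Function.update (fun _ => LinearMap.id) i (θ.smulRight u) :
      Fin m → (V →ₗ[ℝ] V)) j (x j)) = Function.update x i (θ (x i) • u) := by
    ext j
    by_cases h : j = i
    · subst h; simp
    · simp [h]
  rw [this]
  have := a.map_update_smul x i (θ (x i)) u
  simpa using this

theorem expand {m : ℕ} (a : V [⋀^Fin m]→ₗ[ℝ] ℝ) (c : Fin m → ℝ) (u : V) (s : Finset (Fin m)) :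
    ∀ x : Fin m → V, a (fun i => x i + if i ∈ s then c i • u else 0)
      = a x + ∑ i ∈ s, c i * a (Function.update x i u) := by
  induction s using Finset.induction_on with
  | empty => intro x; simp
  | insert j s hj ih =>
    intro x
    have e1 : (fun i => x i + if i ∈ insert j s then c i • u else 0) =
        Function.update (fun i => x i + if i ∈ s then c i • u else 0) j (x j + c j • u) := by
      ext i
      by_cases h : i = j
      · subst h; simp
      · simp [h]
    have e2 : Function.update (fun i => x i + if i ∈ s then c i • u else 0) j (x j) =
        (fun i => x i + if i ∈ s then c i • u else 0) := by
      ext i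
      by_cases h : i = j
      · subst h; simp [hj]
      · simp [h]
    have e3 : Function.update (fun i => x i + if i ∈ s then c i • u else 0) j u =
        (fun i => Function.update x j u i + if i ∈ s then c i • u else 0) := by
      ext i
      by_cases h : i = j
      · subst h; simp [hj]
      · simp [h]
    rw [e1, a.map_update_add, a.map_update_smul, e2, e3, ih, ih, Finset.sum_insert hj]
    have e4 : ∑ i ∈ s, c i * a (Function.update (Function.update x j u) i u) = 0 := by
      refine Finset.sum_eq_zero fun i hi => ?_
      have hij : i ≠ j := fun h => hj (h ▸ hi)
      rw [a.map_eq_zero_of_eq _ (i := i) (j := j) (by simp [hij.symm]) hij, mul_zero]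
    rw [e4, smul_eq_mul]; ring

theorem Mder_self [FiniteDimensional ℝ V] (B : V →ₗ[ℝ] V →ₗ[ℝ] ℝ)
    {m : ℕ} (a : V [⋀^Fin m]→ₗ[ℝ] ℝ)
    (T : ∀ w t (x : Fin m → V), a (fun i => Tv B w t (x i)) = a x) (u : V) :
    Mder a (B u) u = 0 := by
  ext x
  rw [Mder_apply]
  have h1 := T u 1 x
  have h2 := expand a (fun i => B u (x i)) u Finset.univ x
  simp only [Tv_apply, one_mul] at h1
  simp only [Finset.mem_univ, if_true] at h2
  rw [h1] at h2
  simp only [_root_.zero_apply]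
  linarith

theorem Mder_conj (B : V →ₗ[ℝ] V →ₗ[ℝ] ℝ) (alt : ∀ v, B v v = 0)
    {m : ℕ} (a : V [⋀^Fin m]→ₗ[ℝ] ℝ)
    (T : ∀ w t (x : Fin m → V), a (fun i => Tv B w t (x i)) = a x) (z u w : V)
    (h : Mder a (B z) u = 0) : Mder a (B (Tv B w 1 z)) (Tv B w 1 u) = 0 := by
  ext x
  have h' := congrArg (fun M => M (fun i => Tv B w (-1) (x i))) h
  have c2 : ∀ v, Tv B w 1 (Tv B w (-1) v) = v := fun v => by
    rw [Tv_comp B alt, add_neg_cancel, Tv_zero]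
  simp only [Mder_apply, _root_.zero_apply] at h' ⊢
  rw [← h']
  refine Finset.sum_congr rfl fun i _ => ?_
  rw [← Tv_symp B alt w 1 z, c2, ← T w 1 (Function.update _ i u)]
  congr 2
  ext j
  by_cases hj : j = i
  · subst hj; simp
  · simp [hj, c2]

theorem Mder_add {m : ℕ} (a : V [⋀^Fin m]→ₗ[ℝ] ℝ) (θ η : V →ₗ[ℝ] ℝ) (u : V) :
    Mder a (θ + η) u = Mder a θ u + Mder a η u := by
  ext x
  simp only [Mder_apply, _root_.add_apply, LinearMap.add_apply, add_mul,
    Finset.sum_add_distrib]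

theorem Mder_smul {m : ℕ} (a : V [⋀^Fin m]→ₗ[ℝ] ℝ) (c : ℝ) (θ : V →ₗ[ℝ] ℝ) (u : V) :
    Mder a (c • θ) u = c • Mder a θ u := by
  ext x
  simp only [Mder_apply, _root_.smul_apply, LinearMap.smul_apply, smul_eq_mul,
    Finset.mul_sum, mul_assoc]

/-- If `a` is killed by contraction with one nonzero vector then `a = 0`. -/
theorem zero_of_contract (B : V →ₗ[ℝ] V →ₗ[ℝ] ℝ) (alt : ∀ v, B v v = 0)
    (nd : ∀ v, v ≠ 0 → ∃ w, B v w ≠ 0) {m : ℕ} (a : V [⋀^Fin m]→ₗ[ℝ] ℝ)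
    (T : ∀ w t (x : Fin m → V), a (fun i => Tv B w t (x i)) = a x) (i0 : Fin m)
    (u : V) (hu : u ≠ 0) (h : ∀ y, a (Function.update y i0 u) = 0) : a = 0 := by
  have h1 : ∀ w, B w u ≠ 0 → ∀ y, a (Function.update y i0 w) = 0 := by
    intro w hw y
    have c2 : ∀ v, Tv B w 1 (Tv B w (-1) v) = v := fun v => by
      rw [Tv_comp B alt, add_neg_cancel, Tv_zero]
    have e := T w 1 (Function.update (fun i => Tv B w (-1) (y i)) i0 u)
    rw [h] at e
    have e2 : (fun i => Tv B w 1 (Function.update (fun i => Tv B w (-1) (y i)) i0 u i)) =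
        Function.update y i0 (u + B w u • w) := by
      ext j
      by_cases hj : j = i0
      · subst hj; simp [Tv_apply]
      · simp [hj, c2]
    rw [e2, a.map_update_add, h, a.map_update_smul, zero_add, smul_eq_mul] at e
    exact (mul_eq_zero.mp e).resolve_left hw
  obtain ⟨w0, hw0⟩ := nd u hu
  rw [B_anti B alt, neg_ne_zero] at hw0
  ext y
  have hy : a (Function.update y i0 (y i0)) = 0 := by
    by_cases hc : B (y i0) u = 0
    · have e : a (Function.update y i0 (y i0 + w0)) = 0 :=
        h1 _ (by rw [map_add, LinearMap.add_apply, hc, zero_add]; exact hw0) y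
      rw [a.map_update_add, h1 w0 hw0, add_zero] at e
      exact e
    · exact h1 _ hc y
  simpa using hy

theorem exists_orth [FiniteDimensional ℝ V] {k : ℕ} (hk : k < Module.finrank ℝ V)
    (B : V →ₗ[ℝ] V →ₗ[ℝ] ℝ) (y : Fin k → V) : ∃ w, w ≠ 0 ∧ ∀ i, B w (y i) = 0 := by
  let f : V →ₗ[ℝ] (Fin k → ℝ) := LinearMap.pi fun i => B.flip (y i)
  have : LinearMap.ker f ≠ ⊥ := LinearMap.ker_ne_bot_of_finrank_lt (by simpa using hk)
  obtain ⟨w, hw, hw0⟩ := Submodule.exists_mem_ne_zero_of_ne_bot this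
  refine ⟨w, hw0, fun i => ?_⟩
  exact congrFun (LinearMap.mem_ker.mp hw) i

theorem Mder_unique [FiniteDimensional ℝ V] (B : V →ₗ[ℝ] V →ₗ[ℝ] ℝ) (alt : ∀ v, B v v = 0)
    (nd : ∀ v, v ≠ 0 → ∃ w, B v w ≠ 0) {m : ℕ} (a : V [⋀^Fin m]→ₗ[ℝ] ℝ) (ha : a ≠ 0)
    (T : ∀ w t (x : Fin m → V), a (fun i => Tv B w t (x i)) = a x) (i0 : Fin m)
    (hm : m < Module.finrank ℝ V) (u : V) (hu : u ≠ 0) (z : V) (hz : Mder a (B z) u = 0) :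
    ∃ c : ℝ, z = c • u := by
  by_contra hcon
  apply ha
  have anti := B_anti B alt
  -- some `w0 ⊥ u` is not orthogonal to `z`
  have hw0 : ∃ w0, B w0 u = 0 ∧ B w0 z ≠ 0 := by
    by_contra hno
    push Not at hno
    apply hcon
    obtain ⟨p, hp⟩ := nd u hu
    rw [anti, neg_ne_zero] at hp
    refine ⟨B p z / B p u, ?_⟩
    by_contra hne
    obtain ⟨q, hq⟩ := nd _ (sub_ne_zero.mpr hne)
    apply hq
    have := hno (q - (B q u / B p u) • p) (by simp [hp])
    rw [anti]
    simp only [map_sub, map_smul, LinearMap.sub_apply, LinearMap.smul_apply, smul_eq_mul] at this ⊢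
    field_simp at this ⊢
    linarith
  have step : ∀ w, B w u = 0 → B w z ≠ 0 → Mder a (B w) u = 0 := by
    intro w hwu hwz
    have e := Mder_conj B alt a T z u w hz
    rw [Tv_apply, Tv_apply, hwu] at e
    simp only [mul_zero, zero_smul, add_zero, one_mul, map_add, map_smul, Mder_add, Mder_smul,
      hz, zero_add] at e
    exact (smul_eq_zero.mp e).resolve_left hwz
  obtain ⟨w0, hw0u, hw0z⟩ := hw0
  have all : ∀ w, B w u = 0 → Mder a (B w) u = 0 := by
    intro w hwu
    by_cases hwz : B w z = 0
    · have e := step (w + w0) (by simp [hwu, hw0u]) (by simpa [hwz] using hw0z)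
      rw [map_add, Mder_add, step w0 hw0u hw0z, add_zero] at e
      exact e
    · exact step w hwu hwz
  refine zero_of_contract B alt nd a T i0 u hu fun y => ?_
  obtain ⟨w, hw, hwy⟩ := exists_orth hm B (Function.update y i0 u)
  have hwu : B w u = 0 := by simpa using hwy i0
  obtain ⟨x, hx⟩ := nd w hw
  have e := congrArg (fun M => M (Function.update y i0 x)) (all w hwu)
  simp only [Mder_apply, _root_.zero_apply] at e
  rw [Finset.sum_eq_single i0] at e
  · simp only [Function.update_self, Function.update_idem] at e
    exact (mul_eq_zero.mp e).resolve_left hx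
  · intro j _ hj
    have := hwy j
    rw [Function.update_of_ne hj] at this
    rw [Function.update_of_ne hj, this, zero_mul]
  · simp
end

theorem upd0 {V : Type} (x y t : V) : Function.update ![x, y] 0 t = ![t, y] := by
  ext i; fin_cases i <;> rfl

theorem upd1 {V : Type} (x y t : V) : Function.update ![x, y] 1 t = ![x, t] := by
  ext i; fin_cases i <;> rfl

/-- The bilinear map underlying an alternating 2-form. -/
def bil {V : Type} [AddCommGroup V] [Module ℝ V] (ω : V [⋀^Fin 2]→ₗ[ℝ] ℝ) :
    V →ₗ[ℝ] V →ₗ[ℝ] ℝ :=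
  LinearMap.mk₂ ℝ (fun v w => ω ![v, w])
    (fun x y z => by simpa only [upd0] using ω.map_update_add ![x, z] 0 x y)
    (fun c x z => by simpa only [upd0] using ω.map_update_smul ![x, z] 0 c x)
    (fun x y z => by simpa only [upd1] using ω.map_update_add ![x, y] 1 y z)
    (fun c x z => by simpa only [upd1] using ω.map_update_smul ![x, z] 1 c z)

theorem bil_apply {V : Type} [AddCommGroup V] [Module ℝ V] (ω : V [⋀^Fin 2]→ₗ[ℝ] ℝ) (v w : V) :
    bil ω v w = ω ![v, w] := rfl

theorem surj_of_nd {V : Type} [AddCommGroup V] [Module ℝ V] [FiniteDimensional ℝ V]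
    (B : V →ₗ[ℝ] V →ₗ[ℝ] ℝ)
    (nd : ∀ v, v ≠ 0 → ∃ w, B v w ≠ 0) (θ : V →ₗ[ℝ] ℝ) : ∃ z, B z = θ := by
  have hinj : Function.Injective B := by
    rw [← LinearMap.ker_eq_bot, LinearMap.ker_eq_bot']
    intro v hv
    by_contra h
    obtain ⟨w, hw⟩ := nd v h
    exact hw (by rw [hv]; rfl)
  have : Function.Surjective B :=
    (LinearMap.injective_iff_surjective_of_finrank_eq_finrank
      (Subspace.dual_finrank_eq (K := ℝ) (V := V)).symm).mp hinj
  exact this θ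

theorem exists_phi (r : ℝ) (hr : r ≠ 0) : ∃ φ : ℝ →ₗ[ℚ] ℚ, φ r = 1 := by
  obtain ⟨f, hf⟩ : ∃ f : Module.Dual ℚ ℝ, f r ≠ 0 := by
    by_contra hcon
    push Not at hcon
    exact hr ((Module.forall_dual_apply_eq_zero_iff ℚ r).mp hcon)
  exact ⟨(f r)⁻¹ • f, by simp [hf]⟩

/-- Let `ω` be an irrational linear symplectic form on `ℝ^{2n}` (no nonzero real multiple of
`ω` takes only rational values on pairs of standard basis vectors), and let `a` be a nonzero
alternating `2l`-form (`1 ≤ l ≤ n − 1`) whose values on tuples of standard basis vectors are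
all rational.  Then there is a linear complex structure `J` on `ℝ^{2n}` compatible with `ω`
that does not preserve `a`. -/
theorem stmt12 (n : ℕ) (hn : 2 ≤ n)
    (ω : (Fin (2 * n) → ℝ) [⋀^Fin 2]→ₗ[ℝ] ℝ)
    (hnd : ∀ v : Fin (2 * n) → ℝ, v ≠ 0 → ∃ w, ω ![v, w] ≠ 0)
    (hirr : ¬ ∃ lam : ℝ, lam ≠ 0 ∧
      ∀ i j : Fin (2 * n), ∃ q : ℚ, lam * ω ![stdVec (2 * n) i, stdVec (2 * n) j] = (q : ℝ))
    (l : ℕ) (hl1 : 1 ≤ l) (hl2 : l ≤ n - 1)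
    (a : (Fin (2 * n) → ℝ) [⋀^Fin (2 * l)]→ₗ[ℝ] ℝ) (ha : a ≠ 0)
    (hrat : ∀ f : Fin (2 * l) → Fin (2 * n),
      ∃ q : ℚ, a (fun i => stdVec (2 * n) (f i)) = (q : ℝ)) :
    ∃ J : (Fin (2 * n) → ℝ) →ₗ[ℝ] (Fin (2 * n) → ℝ),
      (∀ v, J (J v) = -v) ∧
      (∀ x y, ω ![J x, J y] = ω ![x, y]) ∧
      (∀ v, v ≠ 0 → 0 < ω ![v, J v]) ∧
      ∃ v : Fin (2 * l) → (Fin (2 * n) → ℝ), a (fun i => J (v i)) ≠ a v := by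
  by_contra hno
  push Not at hno
  let B := bil ω
  have hB : ∀ v w, B v w = ω ![v, w] := fun v w => rfl
  have alt : ∀ v, B v v = 0 := fun v => by
    rw [hB]
    exact ω.map_eq_zero_of_eq _ (i := 0) (j := 1) (by simp) (by decide)
  have nd : ∀ v, v ≠ 0 → ∃ w, B v w ≠ 0 := hnd
  have H : ∀ J, CompatJ B J → ∀ x : Fin (2 * l) → (Fin (2 * n) → ℝ), a (fun i => J (x i)) = a x :=
    fun J hJ => hno J hJ.1 hJ.2.1 hJ.2.2
  have T := inv_Tv B alt nd a H
  let i0 : Fin (2 * l) := ⟨0, by omega⟩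
  have hfr : 2 * l < Module.finrank ℝ (Fin (2 * n) → ℝ) := by
    rw [Module.finrank_fin_fun]; omega
  let e : Module.Basis (Fin (2 * n)) ℝ (Fin (2 * n) → ℝ) := Pi.basisFun ℝ (Fin (2 * n))
  have he : ∀ i, e i = stdVec (2 * n) i := fun i => by simp [e, stdVec]
  have hrat' : ∀ f : Fin (2 * l) → Fin (2 * n), ∃ q : ℚ, a (fun i => e (f i)) = (q : ℝ) := by
    intro f; simpa only [he] using hrat f
  -- main step: apply a rational functional
  have main : ∀ (φ : ℝ →ₗ[ℚ] ℚ) (u : Fin (2 * n) → ℝ), u ≠ 0 →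
      (∀ (f : Fin (2 * l) → Fin (2 * n)) i, ∃ q : ℚ,
        a (Function.update (fun i => e (f i)) i u) = (q : ℝ)) →
      ∃ c : ℝ, ∀ j, ((φ (B u (e j)) : ℚ) : ℝ) = c * B u (e j) := by
    intro φ u hu hq
    let θ : (Fin (2 * n) → ℝ) →ₗ[ℝ] ℝ := e.constr ℝ fun j => ((φ (B u (e j)) : ℚ) : ℝ)
    have hθ : ∀ j, θ (e j) = ((φ (B u (e j)) : ℚ) : ℝ) := fun j => by
      simp only [θ, Module.Basis.constr_basis]
    obtain ⟨z, hz⟩ := surj_of_nd B nd θ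
    have hM : Mder a (B z) u = 0 := by
      rw [hz]
      refine Module.Basis.ext_multilinear (fun _ => e) fun f => ?_
      have h0 := congrArg (fun M => M (fun i => e (f i))) (Mder_self B a T u)
      simp only [Mder_apply, _root_.zero_apply, hθ] at h0 ⊢
      choose q hq' using hq f
      simp only [hq'] at h0 ⊢
      have h1 := congrArg φ h0
      rw [map_sum, map_zero] at h1
      have h2 : ∀ (r : ℝ) (q : ℚ), φ (r * q) = φ r * q := fun r q => by
        rw [mul_comm r, ← Rat.smul_def, map_smul, smul_eq_mul, mul_comm]
      simp only [h2] at h1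
      exact_mod_cast h1
    obtain ⟨c, hc⟩ := Mder_unique B alt nd a ha T i0 hfr u hu z hM
    refine ⟨c, fun j => ?_⟩
    rw [← hθ, ← hz, hc, map_smul, LinearMap.smul_apply, smul_eq_mul]
  -- choose a nonzero entry
  have hent : ∃ p q, B (e p) (e q) ≠ 0 := by
    by_contra hall
    push Not at hall
    have hB0 : B = 0 := by
      refine e.ext fun i => e.ext fun j => ?_
      simp [hall]
    let k0 : Fin (2 * n) := ⟨0, by omega⟩
    obtain ⟨w, hw⟩ := nd (e k0) (e.ne_zero k0)
    exact hw (by rw [hB0]; rfl)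
  obtain ⟨p, q, hpq⟩ := hent
  obtain ⟨φ, hφ⟩ := exists_phi _ hpq
  have upd : ∀ (f : Fin (2 * l) → Fin (2 * n)) i k,
      Function.update (fun i => e (f i)) i (e k) = fun j => e (Function.update f i k j) := by
    intro f i k
    ext j
    by_cases h : j = i
    · subst h; simp
    · simp [h]
  have hc1 : ∀ i, ∃ c : ℝ, ∀ j, ((φ (B (e i) (e j)) : ℚ) : ℝ) = c * B (e i) (e j) := by
    intro i
    refine main φ (e i) (e.ne_zero i) fun f k => ?_
    rw [upd]; exact hrat' _
  choose c hc using hc1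
  have hcc : ∀ i, c i = c p := by
    intro i
    by_cases hip : i = p
    · rw [hip]
    have hli : ∀ s t : ℝ, s • e i + t • e p = 0 → s = 0 ∧ t = 0 := by
      have := (e.linearIndependent.comp ![i, p] (by
        intro x y hxy
        have hpi : p ≠ i := fun h => hip h.symm
        fin_cases x <;> fin_cases y <;> simp_all))
      have h2 : LinearIndependent ℝ ![e i, e p] := by
        convert this using 1
        ext x; fin_cases x <;> simp
      exact LinearIndependent.pair_iff.mp h2
    have hne : e i + e p ≠ 0 := fun h => by
      have := hli 1 1 (by simpa using h)
      exact one_ne_zero this.1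
    obtain ⟨d, hd⟩ := main φ (e i + e p) hne (by
      intro f k
      rw [a.map_update_add, upd, upd]
      obtain ⟨q1, h1⟩ := hrat' (Function.update f k i)
      obtain ⟨q2, h2⟩ := hrat' (Function.update f k p)
      exact ⟨q1 + q2, by rw [h1, h2]; push_cast; rfl⟩)
    have hz : (d - c i) • e i + (d - c p) • e p = 0 := by
      by_contra hnz
      obtain ⟨w, hw⟩ := nd _ hnz
      apply hw
      have : B ((d - c i) • e i + (d - c p) • e p) = 0 := by
        refine e.ext fun j => ?_
        have h1 := hd j
        rw [map_add, LinearMap.add_apply, map_add] at h1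
        push_cast at h1
        rw [hc i j, hc p j] at h1
        simp only [map_add, map_smul, LinearMap.add_apply, LinearMap.smul_apply, smul_eq_mul,
          LinearMap.zero_apply]
        linarith
      rw [this]; rfl
    obtain ⟨h1, h2⟩ := hli _ _ hz
    linarith
  apply hirr
  refine ⟨c p, ?_, ?_⟩
  · intro h0
    have := hc p q
    rw [hφ, h0] at this
    simp at this
  · intro i j
    refine ⟨φ (B (e i) (e j)), ?_⟩
    rw [hc i j, hcc i, hB, he, he]

end
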